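/- (Regularity Lemma.) Fix n ≥ 3 and h = 10⁻⁹ n⁻². Fix points (x₁,y₁) ∈ [−h²,h²]×[−1−h²,−1+h²], points (xᵢ,yᵢ) ∈ [−h²,h²]×[−h²,h²] for i = 2,…,n−1, and a value yₙ ∈ [1−h²,1+h²]. For x ∈ [−h,h] consider the data set with xₙ = x, and define G(δ,θ;x) = z̄ − ū² − 2w̄ + 2ūw̄δ − w̄²δ² on Ω = {(δ,θ) : |δ| ≤ 100h, |θ| ≤ 100h}, where uᵢ = xᵢcosθ + yᵢsinθ, vᵢ = −xᵢsinθ + yᵢcosθ, zᵢ = xᵢ² + yᵢ², wᵢ = vᵢ²/(√(1−2uᵢδ+zᵢδ²) + 1 − uᵢδ), and bars denote sample means. Then for each x ∈ [−h,h], G(·,·;x) has a unique minimum (δ̂(x), θ̂(x)) in Ω, and the function ζ(x) = δ̂(x)/cos(θ̂(x)) is differentiable in x with |ζ′(x)| ≤ D, where D > 0 is a constant depending only on n and h (not on the fixed coordinates). -/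

import Mathlib

open Real

/-- `u = x cos θ + y sin θ`. -/
noncomputable def uFun (x y θ : ℝ) : ℝ := x * Real.cos θ + y * Real.sin θ

/-- `v = −x sin θ + y cos θ`. -/
noncomputable def vFun (x y θ : ℝ) : ℝ := -x * Real.sin θ + y * Real.cos θ

/-- `z = x² + y²`. -/
def zFun (x y : ℝ) : ℝ := x ^ 2 + y ^ 2

/-- `w = v² / (√(1 − 2uδ + zδ²) + 1 − uδ)`. -/
noncomputable def wFun (x y δ θ : ℝ) : ℝ :=
  (vFun x y θ) ^ 2 /
    (Real.sqrt (1 - 2 * uFun x y θ * δ + zFun x y * δ ^ 2) + 1 - uFun x y θ * δ)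

/-- The circle-fit objective in reciprocal-polar coordinates:
`G(δ,θ) = z̄ − ū² − 2w̄ + 2ūw̄δ − w̄²δ²` (bars = sample means). -/
noncomputable def Gfun {n : ℕ} (px py : Fin n → ℝ) (δ θ : ℝ) : ℝ :=
  (∑ i, zFun (px i) (py i)) / n - ((∑ i, uFun (px i) (py i) θ) / n) ^ 2
    - 2 * ((∑ i, wFun (px i) (py i) δ θ) / n)
    + 2 * ((∑ i, uFun (px i) (py i) θ) / n) * ((∑ i, wFun (px i) (py i) δ θ) / n) * δ
    - ((∑ i, wFun (px i) (py i) δ θ) / n) ^ 2 * δ ^ 2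

/-- `f` and `f'`, the values of a quantity at two states at distance at most `N`, are within `ε` of
`c`, and their difference is within `ε * N` of `l`. -/
structure Near (N ε c l f f' : ℝ) : Prop where
  left : |f - c| ≤ ε
  right : |f' - c| ≤ ε
  diff : |f - f' - l| ≤ ε * N

namespace Near

variable {N ε ε₁ ε₂ c d l m f f' g g' : ℝ}

theorem weaken (h : Near N ε₁ c l f f') (hN : 0 ≤ N) (hε : ε₁ ≤ ε₂) (hc : c = d) (hl : l = m) :
    Near N ε₂ d m f f' := by
  subst hc hl
  exact ⟨h.left.trans hε, h.right.trans hε, h.diff.trans (mul_le_mul_of_nonneg_right hε hN)⟩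

theorem of_abs_le (hN : 0 ≤ N) (hf : |f| ≤ ε) (hf' : |f'| ≤ ε) : Near N ε 0 (f - f') f f' :=
  ⟨by simpa using hf, by simpa using hf',
    by simpa using mul_nonneg ((abs_nonneg _).trans hf) hN⟩

theorem small (h : Near N ε c 0 f f') (hN : 0 ≤ N) {K : ℝ} (hK : |c| + ε ≤ K) :
    Near N K 0 0 f f' := by
  have key : ∀ {a : ℝ}, |a - c| ≤ ε → |a - 0| ≤ K := by
    intro a ha
    have := abs_add_le (a - c) c
    rw [sub_add_cancel] at this
    rw [sub_zero]
    linarith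
  refine ⟨key h.left, key h.right, h.diff.trans (mul_le_mul_of_nonneg_right ?_ hN)⟩
  linarith [abs_nonneg c]

theorem const (hN : 0 ≤ N) (h : |f - c| ≤ ε) : Near N ε c 0 f f :=
  ⟨h, h, by simpa using mul_nonneg ((abs_nonneg _).trans h) hN⟩

theorem add (hf : Near N ε₁ c l f f') (hg : Near N ε₂ d m g g') :
    Near N (ε₁ + ε₂) (c + d) (l + m) (f + g) (f' + g') := by
  obtain ⟨a1, a2, a3⟩ := hf
  obtain ⟨b1, b2, b3⟩ := hg
  rw [abs_le] at *
  constructor <;> rw [abs_le] <;> constructor <;> linarith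

theorem smul (k : ℝ) (hf : Near N ε c l f f') :
    Near N (|k| * ε) (k * c) (k * l) (k * f) (k * f') := by
  obtain ⟨a1, a2, a3⟩ := hf
  refine ⟨?_, ?_, ?_⟩
  · rw [← mul_sub, abs_mul]; gcongr
  · rw [← mul_sub, abs_mul]; gcongr
  · rw [← mul_sub, ← mul_sub, abs_mul, mul_assoc]; gcongr

theorem neg (hf : Near N ε c l f f') : Near N ε (-c) (-l) (-f) (-f') := by
  simpa using hf.smul (-1)

theorem sub (hf : Near N ε₁ c l f f') (hg : Near N ε₂ d m g g') :
    Near N (ε₁ + ε₂) (c - d) (l - m) (f - g) (f' - g') := by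
  have := hf.add (hg.smul (-1))
  simpa [sub_eq_add_neg] using this

theorem mul (hf : Near N ε₁ c l f f') (hg : Near N ε₂ d m g g')
    (hc : |c| ≤ 1) (hd : |d| ≤ 1) (hl : |l| ≤ 2 * N) (hm : |m| ≤ 2 * N)
    (h₁ : ε₁ ≤ 1) (h₂ : ε₂ ≤ 1) :
    Near N (4 * (ε₁ + ε₂)) (c * d) (c * m + d * l) (f * g) (f' * g') := by
  have p₁ : 0 ≤ ε₁ := (abs_nonneg _).trans hf.left
  have p₂ : 0 ≤ ε₂ := (abs_nonneg _).trans hg.left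
  have bd : ∀ {a b e : ℝ}, |a - b| ≤ e → |b| ≤ 1 → e ≤ 1 → |a| ≤ 2 := by
    intro a b e h1 h2 h3
    have := abs_add_le (a - b) b
    rw [sub_add_cancel] at this
    linarith
  have key : ∀ {a b : ℝ}, |a - c| ≤ ε₁ → |b - d| ≤ ε₂ → |a * b - c * d| ≤ 4 * (ε₁ + ε₂) := by
    intro a b ha hb
    have e : a * b - c * d = a * (b - d) + (a - c) * d := by ring
    have := abs_add_le (a * (b - d)) ((a - c) * d)
    rw [e]
    rw [abs_mul, abs_mul] at this
    have t1 := mul_le_mul (bd ha hc h₁) hb (abs_nonneg _) (by norm_num)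
    have t2 := mul_le_mul ha hd (abs_nonneg _) p₁
    linarith
  refine ⟨key hf.left hg.left, key hf.right hg.right, ?_⟩
  have e : f * g - f' * g' - (c * m + d * l) =
      (f * (g - g' - m) + (f - c) * m) + (g' * (f - f' - l) + (g' - d) * l) := by ring
  rw [e]
  have s1 := abs_add_le (f * (g - g' - m) + (f - c) * m) (g' * (f - f' - l) + (g' - d) * l)
  have s2 := abs_add_le (f * (g - g' - m)) ((f - c) * m)
  have s3 := abs_add_le (g' * (f - f' - l)) ((g' - d) * l)
  rw [abs_mul, abs_mul] at s2 s3
  have t1 := mul_le_mul (bd hf.left hc h₁) hg.diff (abs_nonneg _) (by norm_num)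
  have t2 := mul_le_mul hf.left hm (abs_nonneg _) p₁
  have t3 := mul_le_mul (bd hg.right hd h₂) hf.diff (abs_nonneg _) (by norm_num)
  have t4 := mul_le_mul hg.right hl (abs_nonneg _) p₂
  linarith

theorem mul_small (hf : Near N ε₁ 0 0 f f') (hg : Near N ε₂ 0 0 g g') :
    Near N (2 * (ε₁ * ε₂)) 0 0 (f * g) (f' * g') := by
  have p₁ : 0 ≤ ε₁ := (abs_nonneg _).trans hf.left
  have p₂ : 0 ≤ ε₂ := (abs_nonneg _).trans hg.left
  obtain ⟨a1, a2, a3⟩ := hf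
  obtain ⟨b1, b2, b3⟩ := hg
  simp only [sub_zero] at *
  refine ⟨?_, ?_, ?_⟩ <;> simp only [sub_zero]
  · rw [abs_mul]
    have := mul_le_mul a1 b1 (abs_nonneg _) p₁
    have := mul_nonneg p₁ p₂
    linarith
  · rw [abs_mul]
    have := mul_le_mul a2 b2 (abs_nonneg _) p₁
    have := mul_nonneg p₁ p₂
    linarith
  · have e : f * g - f' * g' = f * (g - g') + g' * (f - f') := by ring
    have s := abs_add_le (f * (g - g')) (g' * (f - f'))
    rw [abs_mul, abs_mul] at s
    have t1 := mul_le_mul a1 b3 (abs_nonneg _) p₁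
    have t2 := mul_le_mul b2 a3 (abs_nonneg _) p₂
    rw [e]
    linarith

theorem sqrt (hf : Near N ε 1 0 f f') (hε : ε ≤ 1 / 2) :
    Near N ε 1 0 (√f) (√f') := by
  obtain ⟨a1, a2, a3⟩ := hf
  have p : 0 ≤ ε := (abs_nonneg _).trans a1
  have key : ∀ {a : ℝ}, |a - 1| ≤ ε → 1 / 2 ≤ √a ∧ √a ^ 2 = a := by
    intro a ha
    have := (abs_le.1 ha).1
    exact ⟨Real.le_sqrt_of_sq_le (by linarith), Real.sq_sqrt (by linarith)⟩
  have key2 : ∀ {a : ℝ}, |a - 1| ≤ ε → |√a - 1| ≤ ε := by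
    intro a ha
    obtain ⟨h1, h2⟩ := key ha
    have e : a - 1 = (√a - 1) * (√a + 1) := by linear_combination -h2
    rw [e, abs_mul, abs_of_pos (by linarith : 0 < √a + 1)] at ha
    nlinarith [abs_nonneg (√a - 1)]
  refine ⟨key2 a1, key2 a2, ?_⟩
  obtain ⟨h1, h2⟩ := key a1
  obtain ⟨h3, h4⟩ := key a2
  rw [sub_zero] at *
  have e : f - f' = (√f - √f') * (√f + √f') := by linear_combination h4 - h2
  rw [e, abs_mul, abs_of_pos (by linarith : 0 < √f + √f')] at a3
  nlinarith [abs_nonneg (√f - √f')]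

theorem inv (hf : Near N ε 1 0 f f') (hε : ε ≤ 1 / 4) (hN : 0 ≤ N) :
    Near N (2 * ε) 1 0 f⁻¹ f'⁻¹ := by
  obtain ⟨a1, a2, a3⟩ := hf
  have p : 0 ≤ ε := (abs_nonneg _).trans a1
  have key : ∀ {a : ℝ}, |a - 1| ≤ ε → 3 / 4 ≤ a := by
    intro a ha
    linarith [(abs_le.1 ha).1]
  have key2 : ∀ {a : ℝ}, |a - 1| ≤ ε → |a⁻¹ - 1| ≤ 2 * ε := by
    intro a ha
    have h1 := key ha
    have e : a⁻¹ - 1 = -((a - 1) / a) := by field_simp; ring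
    rw [e, abs_neg, abs_div, abs_of_pos (by linarith : 0 < a), div_le_iff₀ (by linarith)]
    nlinarith
  refine ⟨key2 a1, key2 a2, ?_⟩
  have h1 := key a1
  have h2 := key a2
  rw [sub_zero] at *
  have e : f⁻¹ - f'⁻¹ = -((f - f') / (f * f')) := by
    have : f ≠ 0 := by linarith
    have : f' ≠ 0 := by linarith
    field_simp; ring
  have hp : 9 / 16 ≤ f * f' := by nlinarith
  rw [e, abs_neg, abs_div, abs_of_pos (by linarith : 0 < f * f'), div_le_iff₀ (by linarith)]
  nlinarith [mul_nonneg p hN]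

theorem sum {ι : Type*} (s : Finset ι) {f f' : ι → ℝ} (h : ∀ i ∈ s, Near N ε 0 0 (f i) (f' i)) :
    Near N (s.card * ε) 0 0 (∑ i ∈ s, f i) (∑ i ∈ s, f' i) := by
  refine ⟨?_, ?_, ?_⟩
  · simpa using (Finset.abs_sum_le_sum_abs _ s).trans
      (Finset.sum_le_card_nsmul s _ ε fun i hi => by simpa using (h i hi).left)
  · simpa using (Finset.abs_sum_le_sum_abs _ s).trans
      (Finset.sum_le_card_nsmul s _ ε fun i hi => by simpa using (h i hi).right)
  · rw [sub_zero, ← Finset.sum_sub_distrib, mul_assoc, ← nsmul_eq_mul]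
    exact (Finset.abs_sum_le_sum_abs _ s).trans
      (Finset.sum_le_card_nsmul s _ (ε * N) fun i hi => by simpa using (h i hi).diff)

theorem sin {η a b : ℝ} (ha : |a| ≤ η) (hb : |b| ≤ η) (hη : η ≤ 1) (hN : |a - b| ≤ N) :
    Near N η 0 (a - b) (Real.sin a) (Real.sin b) := by
  have key : ∀ {x : ℝ}, |x| ≤ η → |Real.sin x - 0| ≤ η := by
    intro x hx
    rw [sub_zero]
    exact Real.abs_sin_le_abs.trans hx
  refine ⟨key ha, key hb, ?_⟩
  have hη0 : 0 ≤ η := (abs_nonneg _).trans ha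
  have := (convex_Icc (-η) η).norm_image_sub_le_of_norm_hasDerivWithin_le
    (f := fun x => Real.sin x - x) (f' := fun x => Real.cos x - 1) (C := η)
    (fun x _ => ((Real.hasDerivAt_sin x).sub (hasDerivAt_id x)).hasDerivWithinAt)
    (fun x hx => by
      have h1 := Real.one_sub_sq_div_two_le_cos (x := x)
      have h2 := Real.cos_le_one x
      rw [Real.norm_eq_abs, abs_le]
      have : x ^ 2 ≤ η ^ 2 := sq_le_sq' hx.1 hx.2
      constructor <;> nlinarith)
    (abs_le.1 hb) (abs_le.1 ha)
  rw [Real.norm_eq_abs, Real.norm_eq_abs] at this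
  calc _ = |Real.sin a - a - (Real.sin b - b)| := by ring_nf
    _ ≤ _ := this.trans (by gcongr)

theorem cos {η a b : ℝ} (ha : |a| ≤ η) (hb : |b| ≤ η) (hη : η ≤ 1) (hN : |a - b| ≤ N) :
    Near N η 1 0 (Real.cos a) (Real.cos b) := by
  have hη0 : 0 ≤ η := (abs_nonneg _).trans ha
  have key : ∀ {x : ℝ}, |x| ≤ η → |Real.cos x - 1| ≤ η := by
    intro x hx
    have h1 := Real.one_sub_sq_div_two_le_cos (x := x)
    have h2 := Real.cos_le_one x
    have : x ^ 2 ≤ η ^ 2 := sq_le_sq' (abs_le.1 hx).1 (abs_le.1 hx).2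
    rw [abs_le]
    constructor <;> nlinarith
  refine ⟨key ha, key hb, ?_⟩
  have := (convex_Icc (-η) η).norm_image_sub_le_of_norm_hasDerivWithin_le
    (f := Real.cos) (f' := fun x => -Real.sin x) (C := η)
    (fun x _ => (Real.hasDerivAt_cos x).hasDerivWithinAt)
    (fun x hx => by
      rw [norm_neg]
      exact Real.abs_sin_le_abs.trans (abs_le.2 hx))
    (abs_le.1 hb) (abs_le.1 ha)
  rw [Real.norm_eq_abs, Real.norm_eq_abs] at this
  rw [sub_zero]
  exact this.trans (by gcongr)

end Near

noncomputable def cFun (x y δ θ : ℝ) : ℝ := uFun x y θ - 1 / 2 * (zFun x y * δ)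

/-- Distance from the point to the centre, divided by the distance from the origin to the centre. -/
noncomputable def sFun (x y δ θ : ℝ) : ℝ := √(1 - 2 * (cFun x y δ θ * δ))

/-- Signed distance from the point to the circle through the origin with the given centre. -/
noncomputable def qFun (x y δ θ : ℝ) : ℝ := cFun x y δ θ * (1 / 2 * (1 + sFun x y δ θ))⁻¹

/-- Minus the partial derivative of `qFun` in `δ`. -/
noncomputable def aFun (x y δ θ : ℝ) : ℝ :=
  1 / 2 * (zFun x y - qFun x y δ θ * qFun x y δ θ) * (sFun x y δ θ)⁻¹

/-- The partial derivative of `qFun` in `θ`. -/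
noncomputable def bFun (x y δ θ : ℝ) : ℝ := vFun x y θ * (sFun x y δ θ)⁻¹

theorem near_end {N x x' y σ δ δ' θ θ' e : ℝ} (he : e = 1.2e-8) (hσ : σ ^ 2 = 1)
    (hx : |x| ≤ e) (hx' : |x'| ≤ e) (hy : |y - σ| ≤ e) (hδ : |δ| ≤ e) (hδ' : |δ'| ≤ e)
    (hθ : |θ| ≤ e) (hθ' : |θ'| ≤ e) (hN : |x - x'| + |δ - δ'| + |θ - θ'| ≤ N) :
    Near N (1832 * e) 0 ((x - x') + σ * (θ - θ') - 1 / 2 * (δ - δ'))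
      (qFun x y δ θ) (qFun x' y δ' θ') ∧
    Near N (32608 * e) (1 / 2) 0 (aFun x y δ θ) (aFun x' y δ' θ') ∧
    Near N (3328 * e) σ 0 (bFun x y δ θ) (bFun x' y δ' θ') := by
  have n1 := abs_nonneg (x - x')
  have n2 := abs_nonneg (δ - δ')
  have n3 := abs_nonneg (θ - θ')
  have N0 : 0 ≤ N := by linarith
  have hs : |σ| = 1 := by
    rw [← sq_abs] at hσ
    nlinarith [abs_nonneg σ]
  have ls : |σ * (θ - θ')| ≤ N := by
    rw [abs_mul, hs]; linarith
  have X := Near.of_abs_le N0 hx hx'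
  have Dl := Near.of_abs_le N0 hδ hδ'
  have Y := Near.const N0 hy
  have Sn := Near.sin hθ hθ' (by norm_num [he]) (show _ ≤ N by linarith)
  have Cs := Near.cos hθ hθ' (by norm_num [he]) (show _ ≤ N by linarith)
  have e1 : ∀ {k : ℝ}, k ≤ 80000000 → k * e ≤ 1 := by intro k hk; rw [he]; linarith
  have e0 : e ≤ 1 := by norm_num [he]
  have z1 : |(0 : ℝ)| ≤ 1 := by norm_num
  have o1 : |(1 : ℝ)| ≤ 1 := by norm_num
  have zN : |(0 : ℝ)| ≤ 2 * N := by rw [abs_zero]; linarith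
  have hx2 : |x - x'| ≤ 2 * N := by linarith
  have hd2 : |δ - δ'| ≤ 2 * N := by linarith
  have ht2 : |θ - θ'| ≤ 2 * N := by linarith
  have U : Near N (16 * e) 0 ((x - x') + σ * (θ - θ')) (uFun x y θ) (uFun x' y θ') :=
    ((X.mul Cs z1 o1 hx2 zN e0 e0).add (Y.mul Sn hs.le z1 zN ht2 e0 e0)).weaken N0
      (by linarith) (by ring) (by ring)
  have V : Near N (16 * e) σ 0 (vFun x y θ) (vFun x' y θ') :=
    ((X.neg.mul Sn (by simp) z1 (by rwa [abs_neg]) ht2 e0 e0).add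
      (Y.mul Cs hs.le o1 zN zN e0 e0)).weaken N0 (by linarith) (by ring) (by ring)
  have Z : Near N (16 * e) 1 0 (zFun x y) (zFun x' y) := by
    unfold zFun
    simp only [sq]
    exact ((X.mul X z1 z1 hx2 hx2 e0 e0).add (Y.mul Y hs.le hs.le zN zN e0 e0)).weaken N0
      (by linarith) (by linear_combination hσ) (by ring)
  set l := (x - x') + σ * (θ - θ') - 1 / 2 * (δ - δ') with hl
  have hl2 : |l| ≤ 2 * N := by
    rw [abs_le] at ls ⊢
    constructor <;> linarith [neg_abs_le (x - x'), neg_abs_le (δ - δ'), le_abs_self (x - x'),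
      le_abs_self (δ - δ')]
  have C : Near N (50 * e) 0 l (cFun x y δ θ) (cFun x' y δ' θ') :=
    (U.sub ((Z.mul Dl o1 z1 zN hd2 (e1 (by norm_num)) e0).smul (1 / 2))).weaken N0
      (by norm_num; linarith) (by ring) (by ring)
  have R : Near N (408 * e) 1 0 (1 - 2 * (cFun x y δ θ * δ)) (1 - 2 * (cFun x' y δ' θ' * δ')) :=
    ((Near.const (ε := 0) (c := 1) N0 (by simp)).sub
      ((C.mul Dl z1 z1 hl2 hd2 (e1 (by norm_num)) e0).smul 2)).weaken N0
      (by norm_num; linarith) (by ring) (by ring)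
  have S : Near N (408 * e) 1 0 (sFun x y δ θ) (sFun x' y δ' θ') := R.sqrt (by norm_num [he])
  have T : Near N (408 * e) 1 0 (1 / 2 * (1 + sFun x y δ θ))⁻¹ (1 / 2 * (1 + sFun x' y δ' θ'))⁻¹ :=
    ((((Near.const (ε := 0) (c := 1) N0 (by simp)).add S).smul (1 / 2)).weaken (ε₂ := 204 * e)
      (d := 1) (m := 0) N0 (by norm_num; linarith) (by ring) (by ring)).inv
      (by norm_num [he]) N0 |>.weaken N0 (by linarith) rfl rfl
  have Si : Near N (816 * e) 1 0 (sFun x y δ θ)⁻¹ (sFun x' y δ' θ')⁻¹ :=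
    (S.inv (by norm_num [he]) N0).weaken N0 (by linarith) rfl rfl
  have Q : Near N (1832 * e) 0 l (qFun x y δ θ) (qFun x' y δ' θ') :=
    (C.mul T z1 o1 hl2 zN (e1 (by norm_num)) (e1 (by norm_num))).weaken N0
      (by linarith) (by ring) (by ring)
  refine ⟨Q, ?_, ?_⟩
  · exact (((Z.sub (Q.mul Q z1 z1 hl2 hl2 (e1 (by norm_num)) (e1 (by norm_num)))).smul
      (1 / 2)).weaken (ε₂ := 7336 * e) (d := 1 / 2) (m := 0) N0 (by norm_num; linarith)
      (by ring) (by ring)).mul Si (by norm_num [abs_le]) o1 zN zN (e1 (by norm_num))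
      (e1 (by norm_num)) |>.weaken N0 (by linarith) (by ring) (by ring)
  · exact (V.mul Si hs.le o1 zN zN (e1 (by norm_num)) (e1 (by norm_num))).weaken N0
      (by linarith) (by ring) (by ring)

theorem near_mid {N m x y δ δ' θ θ' : ℝ} (hm : m ≤ 1 / 1000)
    (hx : |x| ≤ m) (hy : |y| ≤ m) (hδ : |δ| ≤ 1) (hδ' : |δ'| ≤ 1)
    (hN : |δ - δ'| + |θ - θ'| ≤ N) :
    Near N (20 * m) 0 0 (qFun x y δ θ) (qFun x y δ' θ') ∧
    Near N (20 * m) 0 0 (aFun x y δ θ) (aFun x y δ' θ') ∧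
    Near N (20 * m) 0 0 (bFun x y δ θ) (bFun x y δ' θ') := by
  have n2 := abs_nonneg (δ - δ')
  have n3 := abs_nonneg (θ - θ')
  have N0 : 0 ≤ N := by linarith
  have m0 : 0 ≤ m := (abs_nonneg _).trans hx
  have m2 : m * m ≤ m / 1000 := by nlinarith
  have X : Near N m 0 0 x x := Near.const N0 (by simpa)
  have Y : Near N m 0 0 y y := Near.const N0 (by simpa)
  have Dl : Near N 1 0 0 δ δ' := ⟨by simpa, by simpa, by simp; linarith⟩
  have Sn : Near N 1 0 0 (Real.sin θ) (Real.sin θ') :=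
    ⟨by simpa using Real.abs_sin_le_one θ, by simpa using Real.abs_sin_le_one θ', by
      have := Real.abs_sin_sub_sin_le θ θ'
      simp only [sub_zero, one_mul]
      linarith⟩
  have Cs : Near N 1 0 0 (Real.cos θ) (Real.cos θ') :=
    ⟨by simpa using Real.abs_cos_le_one θ, by simpa using Real.abs_cos_le_one θ', by
      have := Real.abs_cos_sub_cos_le θ θ'
      simp only [sub_zero, one_mul]
      linarith⟩
  have U : Near N (4 * m) 0 0 (uFun x y θ) (uFun x y θ') :=
    ((X.mul_small Cs).add (Y.mul_small Sn)).weaken N0 (by linarith) (by ring) (by ring)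
  have V : Near N (4 * m) 0 0 (vFun x y θ) (vFun x y θ') :=
    (((X.neg.weaken N0 le_rfl neg_zero neg_zero).mul_small Sn).add (Y.mul_small Cs)).weaken N0
      (by linarith) (by ring) (by ring)
  have Z : Near N m 0 0 (zFun x y) (zFun x y) := by
    unfold zFun
    simp only [sq]
    exact ((X.mul_small X).add (Y.mul_small Y)).weaken N0 (by linarith) (by ring) (by ring)
  have C : Near N (5 * m) 0 0 (cFun x y δ θ) (cFun x y δ' θ') :=
    (U.sub ((Z.mul_small Dl).smul (1 / 2))).weaken N0 (by norm_num; linarith) (by ring) (by ring)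
  have R : Near N (20 * m) 1 0 (1 - 2 * (cFun x y δ θ * δ)) (1 - 2 * (cFun x y δ' θ' * δ')) :=
    ((Near.const (ε := 0) (c := 1) N0 (by simp)).sub
      ((C.mul_small Dl).smul 2)).weaken N0 (by norm_num; linarith) (by ring) (by ring)
  have S : Near N (20 * m) 1 0 (sFun x y δ θ) (sFun x y δ' θ') := R.sqrt (by linarith)
  have T : Near N 2 0 0 (1 / 2 * (1 + sFun x y δ θ))⁻¹ (1 / 2 * (1 + sFun x y δ' θ'))⁻¹ :=
    ((((Near.const (ε := 0) (c := 1) N0 (by simp)).add S).smul (1 / 2)).weaken (ε₂ := 10 * m)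
      (d := 1) (m := 0) N0 (by norm_num; linarith) (by ring) (by ring)).inv
      (by linarith) N0 |>.small N0 (by norm_num; linarith)
  have Si : Near N 2 0 0 (sFun x y δ θ)⁻¹ (sFun x y δ' θ')⁻¹ :=
    (S.inv (by linarith) N0).small N0 (by norm_num; linarith)
  have Q : Near N (20 * m) 0 0 (qFun x y δ θ) (qFun x y δ' θ') :=
    (C.mul_small T).weaken N0 (by linarith) rfl rfl
  refine ⟨Q, ?_, ?_⟩
  · exact (((Z.sub (Q.mul_small Q)).smul (1 / 2)).weaken (ε₂ := m) (d := 0) (m := 0) N0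
      (by norm_num; linarith) (by ring) (by ring)).mul_small Si |>.weaken N0 (by linarith) rfl rfl
  · exact (V.mul_small Si).weaken N0 (by linarith) rfl rfl

theorem Near.sum_fin {N ε₁ ε₂ ε c d l m : ℝ} (hN : 0 ≤ N) {n : ℕ} {i₀ i₁ : Fin n} (hi : i₀ ≠ i₁)
    {f f' : Fin n → ℝ} (h₀ : Near N ε₁ c l (f i₀) (f' i₀)) (h₁ : Near N ε₂ d m (f i₁) (f' i₁))
    (hε : 0 ≤ ε) (h : ∀ i, i ≠ i₀ → i ≠ i₁ → Near N ε 0 0 (f i) (f' i)) :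
    Near N (ε₁ + ε₂ + n * ε) (c + d) (l + m) (∑ i, f i) (∑ i, f' i) := by
  have split : ∀ g : Fin n → ℝ,
      ∑ i, g i = g i₀ + g i₁ + ∑ i ∈ (Finset.univ.erase i₀).erase i₁, g i := by
    intro g
    rw [← Finset.add_sum_erase _ g (Finset.mem_univ i₀), ← Finset.add_sum_erase _ g
      (Finset.mem_erase.2 ⟨hi.symm, Finset.mem_univ i₁⟩), add_assoc]
  rw [split f, split f']
  have hs := Near.sum ((Finset.univ.erase i₀).erase i₁) (f := f) (f' := f') (N := N) (ε := ε)
    fun i hi => by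
      simp only [Finset.mem_erase, Finset.mem_univ, and_true] at hi
      exact h i hi.2 hi.1
  refine ((h₀.add h₁).add hs).weaken hN ?_ (add_zero _) (add_zero _)
  gcongr
  simpa using Finset.card_le_card (Finset.subset_univ ((Finset.univ.erase i₀).erase i₁))

/-- Half the partial derivative in `δ` of `∑ q² - (∑ q)² / n`. -/
noncomputable def gradδ {n : ℕ} (px py : Fin n → ℝ) (δ θ : ℝ) : ℝ :=
  1 / (n : ℝ) * ((∑ i, aFun (px i) (py i) δ θ) * ∑ i, qFun (px i) (py i) δ θ) -
    ∑ i, aFun (px i) (py i) δ θ * qFun (px i) (py i) δ θ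

/-- Half the partial derivative in `θ` of `∑ q² - (∑ q)² / n`. -/
noncomputable def gradθ {n : ℕ} (px py : Fin n → ℝ) (δ θ : ℝ) : ℝ :=
  ∑ i, bFun (px i) (py i) δ θ * qFun (px i) (py i) δ θ -
    1 / (n : ℝ) * ((∑ i, bFun (px i) (py i) δ θ) * ∑ i, qFun (px i) (py i) δ θ)

/-- Points close to `(0, -1)`, `(0, 1)` (for the indices `i₀`, `i₁`) and the origin. -/
structure NearCross {n : ℕ} (h : ℝ) (i₀ i₁ : Fin n) (px py : Fin n → ℝ) : Prop where
  ne : i₀ ≠ i₁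
  three_le : 3 ≤ n
  pos : 0 < h
  le : 100 * h ≤ 1.2e-8
  mul_le : n * h ≤ 1e-9
  first_x : |px i₀| ≤ h ^ 2
  first_y : |py i₀ - -1| ≤ h ^ 2
  last_x : |px i₁| ≤ h
  last_y : |py i₁ - 1| ≤ h ^ 2
  mid_x : ∀ i, i ≠ i₀ → i ≠ i₁ → |px i| ≤ h ^ 2
  mid_y : ∀ i, i ≠ i₀ → i ≠ i₁ → |py i| ≤ h ^ 2

namespace NearCross

variable {n : ℕ} {h : ℝ} {i₀ i₁ : Fin n} {px py : Fin n → ℝ}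

theorem sq_le (H : NearCross h i₀ i₁ px py) : h ^ 2 ≤ h / 1000 := by
  have := H.pos
  have := H.le
  rw [sq]
  nlinarith

theorem abs_x_le (H : NearCross h i₀ i₁ px py) (i : Fin n) : |px i| ≤ 1.1 := by
  have h0 := H.pos
  have hle := H.le
  have hh := H.sq_le
  by_cases h1 : i = i₀
  · subst h1; exact H.first_x.trans (by linarith)
  by_cases h2 : i = i₁
  · subst h2; exact H.last_x.trans (by linarith)
  exact (H.mid_x i h1 h2).trans (by linarith)

theorem abs_y_le (H : NearCross h i₀ i₁ px py) (i : Fin n) : |py i| ≤ 1.01 := by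
  have h0 := H.pos
  have hle := H.le
  have hh := H.sq_le
  by_cases h1 : i = i₀
  · subst h1
    have := abs_le.1 H.first_y
    rw [abs_le]; constructor <;> linarith
  by_cases h2 : i = i₁
  · subst h2
    have := abs_le.1 H.last_y
    rw [abs_le]; constructor <;> linarith
  exact (H.mid_y i h1 h2).trans (by linarith)

end NearCross

theorem grad_near {n : ℕ} {h : ℝ} {i₀ i₁ : Fin n} {px px' py : Fin n → ℝ}
    (H : NearCross h i₀ i₁ px py) (H' : NearCross h i₀ i₁ px' py)
    (hp : ∀ i, i ≠ i₁ → px i = px' i) {δ δ' θ θ' : ℝ} (hδ : |δ| ≤ 100 * h) (hδ' : |δ'| ≤ 100 * h)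
    (hθ : |θ| ≤ 100 * h) (hθ' : |θ'| ≤ 100 * h) :
    |gradδ px py δ θ - gradδ px' py δ' θ' -
        (1 / 2 - 1 / (n : ℝ)) * ((δ - δ') - (px i₁ - px' i₁))| ≤
      1 / 100 * (|px i₁ - px' i₁| + |δ - δ'| + |θ - θ'|) ∧
    |gradθ px py δ θ - gradθ px' py δ' θ' - (2 * (θ - θ') + (px i₁ - px' i₁))| ≤
      1 / 100 * (|px i₁ - px' i₁| + |δ - δ'| + |θ - θ'|) := by
  set N := |px i₁ - px' i₁| + |δ - δ'| + |θ - θ'| with hN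
  have n1 := abs_nonneg (px i₁ - px' i₁)
  have n2 := abs_nonneg (δ - δ')
  have n3 := abs_nonneg (θ - θ')
  have N0 : 0 ≤ N := by linarith
  obtain ⟨e, he⟩ : ∃ e : ℝ, e = 1.2e-8 := ⟨_, rfl⟩
  have h0 := H.pos
  have hle : 100 * h ≤ e := he ▸ H.le
  have hh := H.sq_le
  have hhe : h ^ 2 ≤ e := by linarith
  have hn3 : (3 : ℝ) ≤ n := by exact_mod_cast H.three_le
  have hnm : n * (20 * h ^ 2) ≤ e := by
    have := H.mul_le
    nlinarith
  have h20 : 20 * h ^ 2 ≤ 1 / 100 := by linarith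
  have p0 : px i₀ = px' i₀ := hp i₀ H.ne
  obtain ⟨Q0, A0, B0⟩ := near_end (N := N) (x := px i₀) (x' := px' i₀) he (σ := -1) (by norm_num)
    (H.first_x.trans hhe) (H'.first_x.trans hhe) (H.first_y.trans hhe) (hδ.trans hle)
    (hδ'.trans hle) (hθ.trans hle) (hθ'.trans hle) (by rw [p0, sub_self, abs_zero]; linarith)
  obtain ⟨Q1, A1, B1⟩ := near_end (N := N) he (σ := 1) (by norm_num)
    (H.last_x.trans (by linarith)) (H'.last_x.trans (by linarith)) (H.last_y.trans hhe)
    (hδ.trans hle) (hδ'.trans hle) (hθ.trans hle) (hθ'.trans hle) hN.ge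
  have mid := fun i h1 h2 => near_mid (N := N) (m := h ^ 2) (δ := δ) (δ' := δ') (θ := θ) (θ' := θ')
    (by linarith) (H.mid_x i h1 h2) (H.mid_y i h1 h2)
    (by linarith) (by linarith) (by linarith)
  have eq : ∀ F : ℝ → ℝ → ℝ → ℝ → ℝ, ∀ i, i ≠ i₁ →
      F (px' i) (py i) δ' θ' = F (px i) (py i) δ' θ' := fun F i hi => by rw [hp i hi]
  have bd : ∀ {k : ℝ}, k ≤ 80000000 → k * e ≤ 1 := by intro k hk; rw [he]; linarith
  set τ := px i₁ - px' i₁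
  have lτ := abs_le.1 (le_refl |τ|)
  have lδ := abs_le.1 (le_refl |δ - δ'|)
  have lθ := abs_le.1 (le_refl |θ - θ'|)
  have l0 : |px i₀ - px' i₀ + -1 * (θ - θ') - 1 / 2 * (δ - δ')| ≤ 2 * N := by
    rw [p0, abs_le]; constructor <;> linarith
  have l1 : |τ + 1 * (θ - θ') - 1 / 2 * (δ - δ')| ≤ 2 * N := by
    rw [abs_le]; constructor <;> linarith
  have l2 : |τ - (δ - δ')| ≤ 2 * N := by
    rw [abs_le]; constructor <;> linarith
  have z1 : |(0 : ℝ)| ≤ 1 := by norm_num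
  have o1 : |(1 : ℝ)| ≤ 1 := by norm_num
  have o2 : |(1 / 2 : ℝ)| ≤ 1 := by norm_num [abs_le]
  have o3 : |(-1 : ℝ)| ≤ 1 := by norm_num
  have zN : |(0 : ℝ)| ≤ 2 * N := by rw [abs_zero]; linarith
  have Q : Near N (3665 * e) 0 (τ - (δ - δ')) (∑ i, qFun (px i) (py i) δ θ)
      (∑ i, qFun (px' i) (py i) δ' θ') :=
    (Near.sum_fin (ε := 20 * h ^ 2) N0 H.ne Q0 Q1 (by positivity) fun i h1 h2 => by
      rw [eq qFun _ h2]; exact (mid i h1 h2).1).weaken N0 (by linarith) (by ring) (by linear_combination p0)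
  have A : Near N (65217 * e) 1 0 (∑ i, aFun (px i) (py i) δ θ)
      (∑ i, aFun (px' i) (py i) δ' θ') :=
    (Near.sum_fin (ε := 20 * h ^ 2) N0 H.ne A0 A1 (by positivity) fun i h1 h2 => by
      rw [eq aFun _ h2]; exact (mid i h1 h2).2.1).weaken N0 (by linarith) (by ring) (by ring)
  have B : Near N (6657 * e) 0 0 (∑ i, bFun (px i) (py i) δ θ)
      (∑ i, bFun (px' i) (py i) δ' θ') :=
    (Near.sum_fin (ε := 20 * h ^ 2) N0 H.ne B0 B1 (by positivity) fun i h1 h2 => by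
      rw [eq bFun _ h2]; exact (mid i h1 h2).2.2).weaken N0 (by linarith) (by ring) (by ring)
  have small : ∀ {f f' g g' : ℝ}, Near N (20 * h ^ 2) 0 0 f f' → Near N (20 * h ^ 2) 0 0 g g' →
      Near N (20 * h ^ 2) 0 0 (f * g) (f' * g') := by
    intro f f' g g' h1 h2
    refine (h1.mul_small h2).weaken N0 ?_ rfl rfl
    nlinarith [sq_nonneg h]
  have AQ : Near N (275521 * e) 0 (1 / 2 * (τ - (δ - δ')))
      (∑ i, aFun (px i) (py i) δ θ * qFun (px i) (py i) δ θ)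
      (∑ i, aFun (px' i) (py i) δ' θ' * qFun (px' i) (py i) δ' θ') :=
    (Near.sum_fin (ε := 20 * h ^ 2) N0 H.ne
      (A0.mul Q0 o2 z1 zN l0 (bd (by norm_num)) (bd (by norm_num)))
      (A1.mul Q1 o2 z1 zN l1 (bd (by norm_num)) (bd (by norm_num))) (by positivity)
      fun i h1 h2 => by
        rw [eq qFun _ h2, eq aFun _ h2]
        exact small (mid i h1 h2).2.1 (mid i h1 h2).1).weaken N0
          (by linarith) (by ring) (by linear_combination 1 / 2 * p0)
  have BQ : Near N (41281 * e) 0 (τ + 2 * (θ - θ'))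
      (∑ i, bFun (px i) (py i) δ θ * qFun (px i) (py i) δ θ)
      (∑ i, bFun (px' i) (py i) δ' θ' * qFun (px' i) (py i) δ' θ') :=
    (Near.sum_fin (ε := 20 * h ^ 2) N0 H.ne
      (B0.mul Q0 o3 z1 zN l0 (bd (by norm_num)) (bd (by norm_num)))
      (B1.mul Q1 o1 z1 zN l1 (bd (by norm_num)) (bd (by norm_num))) (by positivity)
      fun i h1 h2 => by
        rw [eq qFun _ h2, eq bFun _ h2]
        exact small (mid i h1 h2).2.2 (mid i h1 h2).1).weaken N0
          (by linarith) (by ring) (by linear_combination -p0)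
  have inv_le : |1 / (n : ℝ)| ≤ 1 / 3 := by
    rw [abs_of_pos (by positivity)]
    exact one_div_le_one_div_of_le (by norm_num) hn3
  have e0 : 0 ≤ e := by linarith
  constructor
  · have := ((((A.mul Q o1 z1 zN l2 (bd (by norm_num)) (bd (by norm_num))).smul
      (1 / (n : ℝ))).sub AQ).weaken (ε₂ := 1 / 100) (d := 0)
      (m := (1 / 2 - 1 / (n : ℝ)) * ((δ - δ') - τ)) N0 ?_ (by ring) (by ring)).diff
    · exact this
    · have := mul_le_mul_of_nonneg_right inv_le
        (by positivity : 0 ≤ 4 * (65217 * e + 3665 * e))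
      linarith
  · have := ((BQ.sub ((B.mul Q z1 z1 zN l2 (bd (by norm_num)) (bd (by norm_num))).smul
      (1 / (n : ℝ)))).weaken (ε₂ := 1 / 100) (d := 0)
      (m := 2 * (θ - θ') + τ) N0 ?_ (by ring) (by ring)).diff
    · exact this
    · have := mul_le_mul_of_nonneg_right inv_le
        (by positivity : 0 ≤ 4 * (6657 * e + 3665 * e))
      linarith

theorem grad_zero_le {n : ℕ} {h : ℝ} {i₀ i₁ : Fin n} {px py : Fin n → ℝ}
    (H : NearCross h i₀ i₁ px py) : |gradδ px py 0 0| ≤ 3 * h ∧ |gradθ px py 0 0| ≤ 3 * h := by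
  have h0 := H.pos
  have hle := H.le
  have hh := H.sq_le
  have hn0 : (0 : ℝ) < n := by exact_mod_cast (by have := H.three_le; omega : 0 < n)
  have hy := H.abs_y_le
  have hs : ∑ i, |px i| ≤ 1.1 * h := by
    rw [← Finset.add_sum_erase _ _ (Finset.mem_univ i₁)]
    have : ∑ i ∈ Finset.univ.erase i₁, |px i| ≤ n * h ^ 2 := by
      refine (Finset.sum_le_card_nsmul _ _ (h ^ 2) fun i hi => ?_).trans ?_
      · by_cases h1 : i = i₀
        · subst h1; exact H.first_x
        · exact H.mid_x i h1 (Finset.ne_of_mem_erase hi)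
      · rw [nsmul_eq_mul]
        gcongr
        simp
    have := H.last_x
    nlinarith [H.mul_le]
  have q0 : ∀ x y, qFun x y 0 0 = x := by
    intro x y; simp [qFun, cFun, sFun, uFun]; norm_num
  have a0 : ∀ x y, aFun x y 0 0 = y ^ 2 / 2 := by
    intro x y; simp [aFun, q0, zFun, sFun]; ring
  have b0 : ∀ x y, bFun x y 0 0 = y := by
    intro x y; simp [bFun, vFun, sFun]
  have key : ∀ w : Fin n → ℝ, (∀ i, |w i| ≤ 1.1) →
      |∑ i, w i * px i| ≤ 1.3 * h ∧ |1 / (n : ℝ) * ((∑ i, w i) * ∑ i, px i)| ≤ 1.3 * h := by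
    intro w hw
    constructor
    · calc _ ≤ ∑ i, |w i * px i| := Finset.abs_sum_le_sum_abs _ _
        _ ≤ ∑ i, 1.1 * |px i| := Finset.sum_le_sum fun i _ => by
          rw [abs_mul]; exact mul_le_mul_of_nonneg_right (hw i) (abs_nonneg _)
        _ ≤ _ := by rw [← Finset.mul_sum]; linarith
    · have h1 : |∑ i, w i| ≤ n * 1.1 :=
        (Finset.abs_sum_le_sum_abs _ _).trans <| by
          simpa using Finset.sum_le_card_nsmul Finset.univ (fun i => |w i|) 1.1 (fun i _ => hw i)
      have h2 : |∑ i, px i| ≤ 1.1 * h := (Finset.abs_sum_le_sum_abs _ _).trans hs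
      rw [abs_mul, abs_mul, abs_of_pos (by positivity), one_div_mul_eq_div, div_le_iff₀ hn0]
      have := mul_le_mul h1 h2 (abs_nonneg _) (by positivity)
      nlinarith
  simp only [gradδ, gradθ, q0, a0, b0]
  have ka := key (fun i => py i ^ 2 / 2) fun i => by
    have := abs_le.1 (hy i)
    rw [abs_of_nonneg (by positivity)]
    nlinarith
  have kb := key py fun i => (hy i).trans (by norm_num)
  simp only [abs_le] at ka kb ⊢
  refine ⟨⟨?_, ?_⟩, ⟨?_, ?_⟩⟩ <;> linarith [ka.1.1, ka.1.2, ka.2.1, ka.2.2, kb.1.1, kb.1.2,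
    kb.2.1, kb.2.2]

theorem half_le_radicand {x y δ θ : ℝ} (hx : |x| ≤ 1.1) (hy : |y| ≤ 1.1) (hδ : |δ| ≤ 1 / 100) :
    1 / 2 ≤ 1 - 2 * (cFun x y δ θ * δ) := by
  have hu : |uFun x y θ| ≤ 2.2 := by
    refine (abs_add_le _ _).trans ?_
    rw [abs_mul, abs_mul]
    have := mul_le_mul hx (Real.abs_cos_le_one θ) (abs_nonneg _) (by norm_num)
    have := mul_le_mul hy (Real.abs_sin_le_one θ) (abs_nonneg _) (by norm_num)
    linarith
  have hz : |zFun x y| ≤ 3 := by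
    have := abs_le.1 hx
    have := abs_le.1 hy
    unfold zFun
    rw [abs_of_nonneg (by positivity)]
    nlinarith
  have hzd := mul_le_mul hz hδ (abs_nonneg _) (by norm_num)
  rw [← abs_mul] at hzd
  have hc : |cFun x y δ θ| ≤ 3 := by
    unfold cFun
    rw [abs_le] at *
    constructor <;> linarith
  have hcd := mul_le_mul hc hδ (abs_nonneg _) (by norm_num)
  rw [← abs_mul, abs_le] at hcd
  linarith

theorem qFun_eq {x y δ θ : ℝ} (hx : |x| ≤ 1.1) (hy : |y| ≤ 1.1) (hδ : |δ| ≤ 1 / 100) :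
    qFun x y δ θ = uFun x y θ - δ * wFun x y δ θ ∧
      qFun x y δ θ ^ 2 = zFun x y - 2 * wFun x y δ θ := by
  have hR := half_le_radicand (θ := θ) hx hy hδ
  have hS : sFun x y δ θ ^ 2 = 1 - 2 * (cFun x y δ θ * δ) := Real.sq_sqrt (by linarith)
  have hS0 : 0 ≤ sFun x y δ θ := Real.sqrt_nonneg _
  have hSw : √(1 - 2 * uFun x y θ * δ + zFun x y * δ ^ 2) = sFun x y δ θ := by
    unfold sFun cFun
    congr 1
    ring
  have hz : zFun x y = uFun x y θ ^ 2 + vFun x y θ ^ 2 := by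
    unfold zFun uFun vFun
    linear_combination (-x ^ 2 - y ^ 2) * Real.sin_sq_add_cos_sq θ
  have hP : 0 < 1 - uFun x y θ * δ := by
    unfold cFun at hR
    have : 0 ≤ zFun x y * δ ^ 2 := by unfold zFun; positivity
    have hu : |uFun x y θ| ≤ 2.2 := by
      refine (abs_add_le _ _).trans ?_
      rw [abs_mul, abs_mul]
      have := mul_le_mul hx (Real.abs_cos_le_one θ) (abs_nonneg _) (by norm_num)
      have := mul_le_mul hy (Real.abs_sin_le_one θ) (abs_nonneg _) (by norm_num)
      linarith
    have hud := mul_le_mul hu hδ (abs_nonneg _) (by norm_num)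
    rw [← abs_mul, abs_le] at hud
    linarith
  have hw : wFun x y δ θ * (sFun x y δ θ + 1 - uFun x y θ * δ) = vFun x y θ ^ 2 := by
    unfold wFun
    rw [hSw, div_mul_cancel₀]
    linarith
  have hq : qFun x y δ θ * (1 + sFun x y δ θ) = 2 * cFun x y δ θ := by
    unfold qFun
    have : 1 + sFun x y δ θ ≠ 0 := by linarith
    field_simp
  have hc : cFun x y δ θ = uFun x y θ - 1 / 2 * (zFun x y * δ) := rfl
  generalize qFun x y δ θ = q at *
  generalize sFun x y δ θ = S at *
  generalize wFun x y δ θ = w at *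
  generalize cFun x y δ θ = c at *
  generalize uFun x y θ = u at *
  generalize vFun x y θ = v at *
  generalize zFun x y = z at *
  subst hc
  have h1 : q = u - δ * w := by
    have hne : (1 + S) * (S + 1 - u * δ) ≠ 0 :=
      mul_ne_zero (by linarith) (by linarith)
    apply mul_right_cancel₀ hne
    linear_combination (S + 1 - u * δ) * hq + δ * (1 + S) * hw - u * hS - δ * (1 + S) * hz
  refine ⟨h1, ?_⟩
  have hne : (S + 1 - u * δ) ≠ 0 := by linarith
  have h2 : δ ^ 2 * w = S - (1 - u * δ) := by
    apply mul_right_cancel₀ hne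
    linear_combination δ ^ 2 * hw - hS - δ ^ 2 * hz
  rw [h1]
  linear_combination hw + w * h2 - hz

/-- The objective of the circle fit, in terms of signed distances. -/
noncomputable def fitFun {n : ℕ} (px py : Fin n → ℝ) (δ θ : ℝ) : ℝ :=
  ∑ i, qFun (px i) (py i) δ θ ^ 2 - 1 / n * (∑ i, qFun (px i) (py i) δ θ) ^ 2

theorem Gfun_eq {n : ℕ} {px py : Fin n → ℝ} {δ θ : ℝ} (hx : ∀ i, |px i| ≤ 1.1)
    (hy : ∀ i, |py i| ≤ 1.1) (hδ : |δ| ≤ 1 / 100) :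
    Gfun px py δ θ = 1 / n * fitFun px py δ θ := by
  unfold Gfun fitFun
  simp only [(qFun_eq (hx _) (hy _) hδ).2]
  simp only [(qFun_eq (hx _) (hy _) hδ).1]
  simp only [Finset.sum_sub_distrib, ← Finset.mul_sum]
  ring

theorem hasDerivAt_qFun {x y δ θ a b : ℝ} (hx : |x| ≤ 1.1) (hy : |y| ≤ 1.1)
    (hδ : |δ| ≤ 1 / 100) :
    HasDerivAt (fun s => qFun x y (δ + s * a) (θ + s * b))
      (b * bFun x y δ θ - a * aFun x y δ θ) 0 := by
  have hR := half_le_radicand (θ := θ) hx hy hδ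
  have dD : HasDerivAt (fun s => δ + s * a) a 0 := by
    simpa using ((hasDerivAt_id (0 : ℝ)).mul_const a).const_add δ
  have dT : HasDerivAt (fun s => θ + s * b) b 0 := by
    simpa using ((hasDerivAt_id (0 : ℝ)).mul_const b).const_add θ
  have dC : HasDerivAt (fun s => cFun x y (δ + s * a) (θ + s * b))
      (vFun x y θ * b - 1 / 2 * (zFun x y * a)) 0 := by
    have := ((dT.cos.const_mul x).add (dT.sin.const_mul y)).sub
      ((dD.const_mul (zFun x y)).const_mul (1 / 2))
    refine this.congr_deriv ?_
    simp only [zero_mul, add_zero, vFun]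
    ring
  have dR := (((dC.mul dD).const_mul 2).const_sub 1)
  have dS := dR.sqrt (by simp only [Pi.mul_apply, zero_mul, add_zero]; linarith)
  have hS0 : 0 < sFun x y δ θ := Real.sqrt_pos.2 (by linarith)
  have dQ := dC.mul (((dS.const_add 1).const_mul (1 / 2)).fun_inv (by
    simp only [Pi.mul_apply, zero_mul, add_zero]
    change (1 / 2 * (1 + sFun x y δ θ)) ≠ 0
    positivity))
  refine dQ.congr_deriv ?_
  simp only [Pi.mul_apply, zero_mul, add_zero]
  rw [show √(1 - 2 * (cFun x y δ θ * δ)) = sFun x y δ θ from rfl]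
  have hS : sFun x y δ θ ^ 2 = 1 - 2 * (cFun x y δ θ * δ) := Real.sq_sqrt (by linarith)
  unfold aFun bFun qFun
  generalize sFun x y δ θ = S at *
  generalize cFun x y δ θ = c at *
  have h1 : 1 + S ≠ 0 := by linarith
  have h2 : S ≠ 0 := hS0.ne'
  field_simp
  linear_combination (2 * vFun x y θ * b - zFun x y * a) * hS

theorem hasDerivAt_fitFun {n : ℕ} {px py : Fin n → ℝ} {δ θ a b : ℝ} (hx : ∀ i, |px i| ≤ 1.1)
    (hy : ∀ i, |py i| ≤ 1.1) (hδ : |δ| ≤ 1 / 100) :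
    HasDerivAt (fun s => fitFun px py (δ + s * a) (θ + s * b))
      (2 * (a * gradδ px py δ θ + b * gradθ px py δ θ)) 0 := by
  have d := fun i => hasDerivAt_qFun (θ := θ) (a := a) (b := b) (hx i) (hy i) hδ
  have := (HasDerivAt.fun_sum (u := Finset.univ) fun i _ => (d i).fun_pow 2).sub
    (((HasDerivAt.fun_sum (u := Finset.univ) fun i _ => d i).fun_pow 2).const_mul (1 / (n : ℝ)))
  refine this.congr_deriv ?_
  simp only [zero_mul, add_zero, gradδ, gradθ, Finset.sum_sub_distrib, ← Finset.mul_sum]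
  have e : ∀ i, ((2 : ℕ) : ℝ) * qFun (px i) (py i) δ θ ^ (2 - 1) *
      (b * bFun (px i) (py i) δ θ - a * aFun (px i) (py i) δ θ) =
      2 * b * (bFun (px i) (py i) δ θ * qFun (px i) (py i) δ θ) -
        2 * a * (aFun (px i) (py i) δ θ * qFun (px i) (py i) δ θ) := by
    intro i; push_cast; ring
  simp only [e, Finset.sum_sub_distrib, ← Finset.mul_sum]
  push_cast
  ring

section

variable {E : Type*} [NormedAddCommGroup E] [NormedSpace ℝ E] {f g k : E → ℝ} {p : E} {y : ℝ}

theorem differentiableAt_pointFun (hf : DifferentiableAt ℝ f p) (hg : DifferentiableAt ℝ g p)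
    (hk : DifferentiableAt ℝ k p) (hx : |f p| ≤ 1.1) (hy : |y| ≤ 1.1) (hδ : |g p| ≤ 1 / 100) :
    DifferentiableAt ℝ (fun p => qFun (f p) y (g p) (k p)) p ∧
    DifferentiableAt ℝ (fun p => aFun (f p) y (g p) (k p)) p ∧
    DifferentiableAt ℝ (fun p => bFun (f p) y (g p) (k p)) p := by
  have hR := half_le_radicand (θ := k p) hx hy hδ
  have dc : DifferentiableAt ℝ (fun p => cFun (f p) y (g p) (k p)) p := by
    unfold cFun uFun zFun
    fun_prop
  have hs : 0 < sFun (f p) y (g p) (k p) := Real.sqrt_pos.2 (by linarith)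
  have ds : DifferentiableAt ℝ (fun p => sFun (f p) y (g p) (k p)) p := by
    unfold sFun
    exact DifferentiableAt.sqrt (by fun_prop) (by linarith)
  have dsi : DifferentiableAt ℝ (fun p => (sFun (f p) y (g p) (k p))⁻¹) p := ds.fun_inv hs.ne'
  have dq : DifferentiableAt ℝ (fun p => qFun (f p) y (g p) (k p)) p := by
    unfold qFun
    refine dc.fun_mul (DifferentiableAt.fun_inv (by fun_prop) ?_)
    positivity
  refine ⟨dq, ?_, ?_⟩
  · unfold aFun zFun
    fun_prop
  · unfold bFun vFun
    fun_prop

theorem differentiableAt_grad {n : ℕ} {f : Fin n → E → ℝ} {py : Fin n → ℝ}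
    (hf : ∀ i, DifferentiableAt ℝ (f i) p) (hg : DifferentiableAt ℝ g p)
    (hk : DifferentiableAt ℝ k p) (hx : ∀ i, |f i p| ≤ 1.1) (hy : ∀ i, |py i| ≤ 1.1)
    (hδ : |g p| ≤ 1 / 100) :
    DifferentiableAt ℝ (fun p => gradδ (fun i => f i p) py (g p) (k p)) p ∧
    DifferentiableAt ℝ (fun p => gradθ (fun i => f i p) py (g p) (k p)) p := by
  have d := fun i => differentiableAt_pointFun (hf i) hg hk (hx i) (hy i) hδ
  have dq := fun i => (d i).1
  have da := fun i => (d i).2.1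
  have db := fun i => (d i).2.2
  unfold gradδ gradθ
  constructor <;> fun_prop

theorem differentiableAt_fitFun {n : ℕ} {px py : Fin n → ℝ} (hg : DifferentiableAt ℝ g p)
    (hk : DifferentiableAt ℝ k p) (hx : ∀ i, |px i| ≤ 1.1) (hy : ∀ i, |py i| ≤ 1.1)
    (hδ : |g p| ≤ 1 / 100) : DifferentiableAt ℝ (fun p => fitFun px py (g p) (k p)) p := by
  have d := fun i =>
    (differentiableAt_pointFun (differentiableAt_const (px i)) hg hk (hx i) (hy i) hδ).1
  unfold fitFun
  fun_prop

end

theorem norm_fderiv_ge_of_eventually {E F : Type*} [NormedAddCommGroup E] [NormedSpace ℝ E]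
    [NormedAddCommGroup F] [NormedSpace ℝ F] {φ : E → F} {φ' : E →L[ℝ] F} {p : E} {k : ℝ}
    (hφ : HasFDerivAt φ φ' p) (hk : ∀ᶠ q in nhds p, k * ‖q - p‖ ≤ ‖φ q - φ p‖) (v : E) :
    k * ‖v‖ ≤ ‖φ' v‖ := by
  have ht := (hφ.hasLineDerivAt v).tendsto_slope_zero.norm
  refine ge_of_tendsto ht ?_
  have hc : Filter.Tendsto (fun t : ℝ => p + t • v) (nhdsWithin 0 {0}ᶜ) (nhds p) := by
    have : Continuous fun t : ℝ => p + t • v := by fun_prop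
    simpa using (this.tendsto 0).mono_left nhdsWithin_le_nhds
  filter_upwards [hc.eventually hk, self_mem_nhdsWithin] with t h1 h2
  have ht0 : 0 < |t| := abs_pos.2 h2
  rw [norm_smul, norm_inv, Real.norm_eq_abs, inv_mul_eq_div, le_div_iff₀ ht0]
  rw [add_sub_cancel_left, norm_smul, Real.norm_eq_abs] at h1
  linarith

/-- Implicit differentiation along a Lipschitz branch of zeros. -/
theorem exists_hasDerivWithinAt_of_zeros {E : Type*} [NormedAddCommGroup E] [NormedSpace ℝ E]
    [FiniteDimensional ℝ E] {f : ℝ × E → E} {D : ℝ × E →L[ℝ] E} {p : ℝ → E} {s : Set ℝ} {t₀ k C : ℝ}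
    (hf : HasFDerivAt f D (t₀, p t₀)) (hk : 0 < k) (hD : ∀ v, k * ‖v‖ ≤ ‖D (0, v)‖)
    (hp : ∀ t ∈ s, ‖p t - p t₀‖ ≤ C * |t - t₀|) (hz : ∀ t ∈ s, f (t, p t) = 0) (ht₀ : t₀ ∈ s) :
    ∃ p', HasDerivWithinAt p p' s t₀ := by
  let M : E →ₗ[ℝ] E := (D.comp (ContinuousLinearMap.inr ℝ ℝ E)).toLinearMap
  have hM : Function.Injective M := by
    rw [injective_iff_map_eq_zero]
    intro v hv
    have h1 := hD v
    rw [show D (0, v) = 0 from hv, norm_zero] at h1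
    exact norm_le_zero_iff.1 (nonpos_of_mul_nonpos_right h1 hk)
  obtain ⟨κ, hκ⟩ := LinearMap.injective_iff_surjective.1 hM (-D (1, 0))
  refine ⟨κ, ?_⟩
  have hcont : Filter.Tendsto (fun t => (t, p t)) (nhdsWithin t₀ s) (nhds (t₀, p t₀)) := by
    refine Filter.Tendsto.prodMk_nhds (Filter.tendsto_id.mono_left nhdsWithin_le_nhds) ?_
    rw [tendsto_iff_norm_sub_tendsto_zero]
    have hb : Filter.Tendsto (fun t => C * |t - t₀|) (nhdsWithin t₀ s) (nhds 0) := by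
      have : Continuous fun t => C * |t - t₀| := by fun_prop
      simpa using (this.tendsto t₀).mono_left nhdsWithin_le_nhds
    exact squeeze_zero' (.of_forall fun _ => norm_nonneg _)
      (by filter_upwards [self_mem_nhdsWithin] with t ht using hp t ht) hb
  have ho := hf.isLittleO.comp_tendsto hcont
  rw [hasDerivWithinAt_iff_isLittleO]
  have hO : ((fun q : ℝ × E => q - (t₀, p t₀)) ∘ fun t => (t, p t)) =O[nhdsWithin t₀ s]
      fun t => t - t₀ := by
    refine Asymptotics.IsBigO.of_bound (max 1 C) ?_
    filter_upwards [self_mem_nhdsWithin] with t ht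
    simp only [Function.comp, Prod.mk_sub_mk, Prod.norm_mk, Real.norm_eq_abs]
    refine max_le ?_ ((hp t ht).trans ?_)
    · exact le_mul_of_one_le_left (abs_nonneg _) (le_max_left _ _)
    · exact mul_le_mul_of_nonneg_right (le_max_right _ _) (abs_nonneg _)
  refine Asymptotics.IsBigO.trans_isLittleO ?_ (ho.trans_isBigO hO)
  refine Asymptotics.IsBigO.of_bound k⁻¹ ?_
  filter_upwards [self_mem_nhdsWithin] with t ht
  simp only [Function.comp, hz t ht, hz t₀ ht₀, sub_self, zero_sub, norm_neg, Prod.mk_sub_mk]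
  rw [inv_mul_eq_div, le_div_iff₀ hk, mul_comm]
  refine (hD _).trans_eq ?_
  congr 1
  have h1 : D (0, κ) = -D (1, 0) := hκ
  have e : (t - t₀, p t - p t₀) =
      ((0 : ℝ), p t - p t₀ - (t - t₀) • κ) + (t - t₀) • (((1 : ℝ), (0 : E)) + (0, κ)) := by
    ext <;> simp
  rw [e, map_add, map_smul, map_add, h1]
  simp

/-- The square on which the objective is minimized. -/
abbrev centralSquare (r : ℝ) : Set (ℝ × ℝ) := Set.Icc (-r) r ×ˢ Set.Icc (-r) r

theorem mem_centralSquare {r : ℝ} {p : ℝ × ℝ} : p ∈ centralSquare r ↔ |p.1| ≤ r ∧ |p.2| ≤ r := by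
  simp only [Set.mem_prod, Set.mem_Icc, abs_le]

namespace NearCross

variable {n : ℕ} {h : ℝ} {i₀ i₁ : Fin n} {px px' py : Fin n → ℝ} {p p' : ℝ × ℝ}

theorem isMinOn_fitFun (H : NearCross h i₀ i₁ px py) (hp : p ∈ centralSquare (100 * h))
    (hm : IsMinOn (fun q : ℝ × ℝ => Gfun px py q.1 q.2) (centralSquare (100 * h)) p) :
    IsMinOn (fun q : ℝ × ℝ => fitFun px py q.1 q.2) (centralSquare (100 * h)) p := by
  have hle := H.le
  have hn : (0 : ℝ) < 1 / n := by
    have := H.three_le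
    have : (0 : ℝ) < n := by exact_mod_cast (by omega : 0 < n)
    positivity
  have hG : ∀ q ∈ centralSquare (100 * h),
      Gfun px py q.1 q.2 = 1 / n * fitFun px py q.1 q.2 := fun q hq =>
    Gfun_eq H.abs_x_le (fun i => (H.abs_y_le i).trans (by norm_num))
      ((mem_centralSquare.1 hq).1.trans (by linarith))
  intro q hq
  have := hm hq
  simp only [Set.mem_ofPred_eq] at this ⊢
  rw [hG p hp, hG q hq] at this
  exact le_of_mul_le_mul_left this hn

theorem variational (H : NearCross h i₀ i₁ px py) (hp : p ∈ centralSquare (100 * h))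
    (hp' : p' ∈ centralSquare (100 * h))
    (hm : IsMinOn (fun q : ℝ × ℝ => Gfun px py q.1 q.2) (centralSquare (100 * h)) p) :
    0 ≤ (p'.1 - p.1) * gradδ px py p.1 p.2 + (p'.2 - p.2) * gradθ px py p.1 p.2 := by
  have hle := H.le
  have hm := H.isMinOn_fitFun hp hm
  have hd := hasDerivAt_fitFun (θ := p.2) (a := p'.1 - p.1) (b := p'.2 - p.2) H.abs_x_le
    (fun i => (H.abs_y_le i).trans (by norm_num)) ((mem_centralSquare.1 hp).1.trans (by linarith))
  have ht := (hasDerivWithinAt_iff_tendsto_slope' (Set.self_notMem_Ioi)).1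
    (hd.hasDerivWithinAt (s := Set.Ioi 0))
  have : 0 ≤ 2 * ((p'.1 - p.1) * gradδ px py p.1 p.2 + (p'.2 - p.2) * gradθ px py p.1 p.2) := by
    refine ge_of_tendsto ht ?_
    filter_upwards [Ioo_mem_nhdsGT (zero_lt_one' ℝ)] with s hs
    have hmem : p + s • (p' - p) ∈ centralSquare (100 * h) :=
      ((convex_Icc _ _).prod (convex_Icc _ _)).add_smul_sub_mem hp hp' ⟨hs.1.le, hs.2.le⟩
    have h1 := hm hmem
    simp only [Set.mem_ofPred_eq, Prod.fst_add, Prod.snd_add, Prod.smul_fst, Prod.smul_snd,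
      Prod.fst_sub, Prod.snd_sub, smul_eq_mul] at h1
    rw [slope_def_field]
    refine div_nonneg ?_ (by linarith [hs.1])
    simpa using h1
  linarith

theorem coeff_bounds (H : NearCross h i₀ i₁ px py) :
    1 / 6 ≤ 1 / 2 - 1 / (n : ℝ) ∧ 1 / 2 - 1 / (n : ℝ) ≤ 1 / 2 := by
  have hn3 : (3 : ℝ) ≤ n := by exact_mod_cast H.three_le
  have h1 : 1 / (n : ℝ) ≤ 1 / 3 := one_div_le_one_div_of_le (by norm_num) hn3
  have h2 : 0 ≤ 1 / (n : ℝ) := by positivity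
  constructor <;> linarith

theorem strong_monotone (H : NearCross h i₀ i₁ px py) (H' : NearCross h i₀ i₁ px' py)
    (hpx : ∀ i, i ≠ i₁ → px i = px' i) (hp : p ∈ centralSquare (100 * h))
    (hp' : p' ∈ centralSquare (100 * h)) :
    (|p.1 - p'.1| + |p.2 - p'.2|) *
        (1 / 8 * (|p.1 - p'.1| + |p.2 - p'.2|) - 1.02 * |px i₁ - px' i₁|) ≤
      (p.1 - p'.1) * (gradδ px py p.1 p.2 - gradδ px' py p'.1 p'.2) +
      (p.2 - p'.2) * (gradθ px py p.1 p.2 - gradθ px' py p'.1 p'.2) := by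
  rw [mem_centralSquare] at hp hp'
  obtain ⟨g1, g2⟩ := grad_near H H' hpx hp.1 hp'.1 hp.2 hp'.2
  obtain ⟨c1, c2⟩ := H.coeff_bounds
  set c := 1 / 2 - 1 / (n : ℝ)
  generalize gradδ px py p.1 p.2 - gradδ px' py p'.1 p'.2 = A at *
  generalize gradθ px py p.1 p.2 - gradθ px' py p'.1 p'.2 = B at *
  generalize p.1 - p'.1 = a at *
  generalize p.2 - p'.2 = b at *
  generalize px i₁ - px' i₁ = τ at *
  have k1 := mul_le_mul_of_nonneg_left g1 (abs_nonneg a)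
  have k2 := mul_le_mul_of_nonneg_left g2 (abs_nonneg b)
  rw [← abs_mul] at k1 k2
  have k1 := (abs_le.1 k1).1
  have k2 := (abs_le.1 k2).1
  have k3 : a * τ ≤ |a| * |τ| := abs_mul a τ ▸ le_abs_self _
  have k4 : -(|b| * |τ|) ≤ b * τ := abs_mul b τ ▸ neg_abs_le _
  have k5 : c * (a * τ) ≤ 1 / 2 * (|a| * |τ|) := by
    have : 0 ≤ |a| * |τ| := by positivity
    nlinarith
  have k6 : 1 / 6 * |a| ^ 2 ≤ c * a ^ 2 := by
    rw [sq_abs]; nlinarith [sq_nonneg a]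
  have k7 := sq_abs b
  have p1 : 0 ≤ |a| * |τ| := by positivity
  have p2 : 0 ≤ |b| * |τ| := by positivity
  nlinarith [sq_nonneg (|a| / 8 - |b|), sq_nonneg |b|, sq_nonneg |a|, sq_nonneg (|a| - 10 * |b|)]

theorem argmin_lipschitz (H : NearCross h i₀ i₁ px py) (H' : NearCross h i₀ i₁ px' py)
    (hpx : ∀ i, i ≠ i₁ → px i = px' i) (hp : p ∈ centralSquare (100 * h))
    (hp' : p' ∈ centralSquare (100 * h))
    (hm : IsMinOn (fun q : ℝ × ℝ => Gfun px py q.1 q.2) (centralSquare (100 * h)) p)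
    (hm' : IsMinOn (fun q : ℝ × ℝ => Gfun px' py q.1 q.2) (centralSquare (100 * h)) p') :
    |p.1 - p'.1| + |p.2 - p'.2| ≤ 10 * |px i₁ - px' i₁| := by
  have h1 := H.variational hp hp' hm
  have h2 := H'.variational hp' hp hm'
  have h3 := strong_monotone H H' hpx hp hp'
  have n1 := abs_nonneg (p.1 - p'.1)
  have n2 := abs_nonneg (p.2 - p'.2)
  have n3 := abs_nonneg (px i₁ - px' i₁)
  by_contra! hlt
  have := mul_pos (by linarith : 0 < |p.1 - p'.1| + |p.2 - p'.2|)
    (by linarith : 0 < 1 / 8 * (|p.1 - p'.1| + |p.2 - p'.2|) - 1.02 * |px i₁ - px' i₁|)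
  linarith

theorem argmin_le (H : NearCross h i₀ i₁ px py) (hp : p ∈ centralSquare (100 * h))
    (hm : IsMinOn (fun q : ℝ × ℝ => Gfun px py q.1 q.2) (centralSquare (100 * h)) p) :
    |p.1| + |p.2| ≤ 24 * h := by
  have h0 := H.pos
  have hz : ((0 : ℝ), (0 : ℝ)) ∈ centralSquare (100 * h) := by
    rw [mem_centralSquare]; simp [h0.le]
  have h1 := H.variational hp hz hm
  have h3 := strong_monotone H H (fun _ _ => rfl) hp hz
  obtain ⟨g1, g2⟩ := grad_zero_le H
  simp only [sub_zero, zero_sub, sub_self, abs_zero, mul_zero] at h1 h3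
  have k1 := mul_le_mul_of_nonneg_left g1 (abs_nonneg p.1)
  have k2 := mul_le_mul_of_nonneg_left g2 (abs_nonneg p.2)
  rw [← abs_mul] at k1 k2
  have k1 := (abs_le.1 k1).1
  have k2 := (abs_le.1 k2).1
  have n1 := abs_nonneg p.1
  have n2 := abs_nonneg p.2
  by_contra! hlt
  nlinarith

theorem grad_eq_zero (H : NearCross h i₀ i₁ px py) (hp : p ∈ centralSquare (100 * h))
    (hm : IsMinOn (fun q : ℝ × ℝ => Gfun px py q.1 q.2) (centralSquare (100 * h)) p) :
    gradδ px py p.1 p.2 = 0 ∧ gradθ px py p.1 p.2 = 0 := by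
  have h0 := H.pos
  have hl := H.argmin_le hp hm
  have n1 := abs_le.1 (le_refl |p.1|)
  have n2 := abs_le.1 (le_refl |p.2|)
  have key : ∀ a b : ℝ, |a| ≤ h → |b| ≤ h →
      0 ≤ a * gradδ px py p.1 p.2 + b * gradθ px py p.1 p.2 := by
    intro a b ha hb
    rw [abs_le] at ha hb
    have := H.variational hp (p' := (p.1 + a, p.2 + b)) (by
      rw [mem_centralSquare, abs_le, abs_le]
      refine ⟨⟨?_, ?_⟩, ⟨?_, ?_⟩⟩ <;> dsimp only <;> linarith [abs_nonneg p.1, abs_nonneg p.2]) hm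
    simpa using this
  have hh : |h| ≤ h := (abs_of_pos h0).le
  have hh' : |-h| ≤ h := by rwa [abs_neg]
  have hz : |(0 : ℝ)| ≤ h := by simpa using h0.le
  have a1 := key h 0 hh hz
  have a2 := key (-h) 0 hh' hz
  have a3 := key 0 h hz hh
  have a4 := key 0 (-h) hz hh'
  constructor <;> nlinarith

theorem existsUnique_argmin (H : NearCross h i₀ i₁ px py) :
    ∃! p : ℝ × ℝ, p ∈ centralSquare (100 * h) ∧
      IsMinOn (fun q : ℝ × ℝ => Gfun px py q.1 q.2) (centralSquare (100 * h)) p := by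
  have h0 := H.pos
  have hle := H.le
  have hG : ∀ q ∈ centralSquare (100 * h),
      Gfun px py q.1 q.2 = 1 / n * fitFun px py q.1 q.2 := fun q hq =>
    Gfun_eq H.abs_x_le (fun i => (H.abs_y_le i).trans (by norm_num))
      ((mem_centralSquare.1 hq).1.trans (by linarith))
  have hc : ContinuousOn (fun q : ℝ × ℝ => Gfun px py q.1 q.2) (centralSquare (100 * h)) := by
    refine ContinuousOn.congr (fun q hq => ContinuousAt.continuousWithinAt ?_) hG
    exact ((differentiableAt_fitFun differentiableAt_fst differentiableAt_snd H.abs_x_le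
      (fun i => (H.abs_y_le i).trans (by norm_num))
      ((mem_centralSquare.1 hq).1.trans (by linarith))).const_mul _).continuousAt
  obtain ⟨p, hp, hm⟩ := (isCompact_Icc.prod isCompact_Icc).exists_isMinOn
    (s := centralSquare (100 * h)) ⟨(0, 0), by rw [mem_centralSquare]; simp [h0.le]⟩ hc
  refine ⟨p, ⟨hp, hm⟩, ?_⟩
  rintro p' ⟨hp', hm'⟩
  have := argmin_lipschitz H H (fun _ _ => rfl) hp' hp hm' hm
  rw [sub_self, abs_zero, mul_zero] at this
  have n1 := abs_nonneg (p'.1 - p.1)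
  have n2 := abs_nonneg (p'.2 - p.2)
  ext
  · exact sub_eq_zero.1 (abs_eq_zero.1 (by linarith))
  · exact sub_eq_zero.1 (abs_eq_zero.1 (by linarith))

theorem norm_grad_sub_ge (H : NearCross h i₀ i₁ px py) (hp : p ∈ centralSquare (100 * h))
    (hp' : p' ∈ centralSquare (100 * h)) :
    1 / 10 * ‖p - p'‖ ≤ ‖(gradδ px py p.1 p.2, gradθ px py p.1 p.2) -
      (gradδ px py p'.1 p'.2, gradθ px py p'.1 p'.2)‖ := by
  rw [mem_centralSquare] at hp hp'
  obtain ⟨g1, g2⟩ := grad_near H H (fun _ _ => rfl) hp.1 hp'.1 hp.2 hp'.2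
  obtain ⟨c1, c2⟩ := H.coeff_bounds
  set c := 1 / 2 - 1 / (n : ℝ)
  rw [Prod.mk_sub_mk, Prod.norm_def, Prod.norm_mk, Prod.fst_sub, Prod.snd_sub]
  simp only [Real.norm_eq_abs]
  generalize gradδ px py p.1 p.2 - gradδ px py p'.1 p'.2 = A at *
  generalize gradθ px py p.1 p.2 - gradθ px py p'.1 p'.2 = B at *
  generalize p.1 - p'.1 = a at *
  generalize p.2 - p'.2 = b at *
  simp only [sub_self, abs_zero, sub_zero, add_zero, zero_add] at g1 g2
  have s1 := abs_sub_abs_le_abs_sub (c * a) A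
  have s2 := abs_sub_abs_le_abs_sub (2 * b) B
  rw [abs_sub_comm, abs_mul, abs_of_pos (by linarith : 0 < c)] at s1
  rw [abs_sub_comm, abs_mul, abs_two] at s2
  rw [abs_sub_comm] at g1 g2
  have n1 := abs_nonneg a
  have n2 := abs_nonneg b
  have s3 : 1 / 6 * |a| ≤ c * |a| := mul_le_mul_of_nonneg_right c1 n1
  rw [abs_sub_comm] at g1 g2
  rcases le_total |a| |b| with hab | hab
  · rw [max_eq_right hab]
    exact le_max_of_le_right (by linarith)
  · rw [max_eq_left hab]
    exact le_max_of_le_left (by linarith)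

end NearCross

/-- A function Lipschitz at a point of a set has bounded derivative there. -/
theorem abs_le_of_hasDerivWithinAt_of_lipschitz {f : ℝ → ℝ} {f' t₀ C : ℝ} {s : Set ℝ}
    (hf : HasDerivWithinAt f f' s t₀) (hs : (nhdsWithin t₀ (s \ {t₀})).NeBot)
    (hC : ∀ t ∈ s, |f t - f t₀| ≤ C * |t - t₀|) : |f'| ≤ C := by
  refine le_of_tendsto (hasDerivWithinAt_iff_tendsto_slope.1 hf).abs ?_
  filter_upwards [self_mem_nhdsWithin] with t ht
  have h0 : 0 < |t - t₀| := abs_pos.2 (sub_ne_zero.2 ht.2)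
  rw [slope_def_field, abs_div, div_le_iff₀ h0]
  exact hC t ht.1

theorem neBot_nhdsWithin_Icc_diff {a b t : ℝ} (hab : a < b) (ht : t ∈ Set.Icc a b) :
    (nhdsWithin t (Set.Icc a b \ {t})).NeBot :=
  accPt_principal_iff_nhdsWithin.1 (uniqueDiffOn_Icc hab t ht).accPt

/-- The branch of minimizers is differentiable in the abscissa of the moving point. -/
theorem exists_hasDerivWithinAt_argmin {n : ℕ} {h : ℝ} {i₀ i₁ : Fin n} {x y : Fin n → ℝ}
    {px : ℝ → Fin n → ℝ} (hpx : ∀ t i, px t i = if i = i₁ then t else x i) {p : ℝ → ℝ × ℝ}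
    (H : ∀ t ∈ Set.Icc (-h) h, NearCross h i₀ i₁ (px t) y)
    (hp : ∀ t ∈ Set.Icc (-h) h, p t ∈ centralSquare (100 * h) ∧
      IsMinOn (fun q : ℝ × ℝ => Gfun (px t) y q.1 q.2) (centralSquare (100 * h)) (p t))
    {t₀ : ℝ} (ht₀ : t₀ ∈ Set.Icc (-h) h) :
    ∃ δ' θ', HasDerivWithinAt (fun t => (p t).1) δ' (Set.Icc (-h) h) t₀ ∧
      HasDerivWithinAt (fun t => (p t).2) θ' (Set.Icc (-h) h) t₀ ∧ |δ'| ≤ 10 ∧ |θ'| ≤ 10 := by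
  have H₀ := H t₀ ht₀
  have h0 := H₀.pos
  have hle := H₀.le
  have hlip : ∀ t ∈ Set.Icc (-h) h,
      |(p t).1 - (p t₀).1| + |(p t).2 - (p t₀).2| ≤ 10 * |t - t₀| := by
    intro t ht
    have := NearCross.argmin_lipschitz (H t ht) H₀ (fun i hi => by
      rw [hpx, hpx, if_neg hi, if_neg hi]) (hp t ht).1 (hp t₀ ht₀).1 (hp t ht).2 (hp t₀ ht₀).2
    rwa [hpx, hpx, if_pos rfl, if_pos rfl] at this
  have hlip1 : ∀ t ∈ Set.Icc (-h) h, |(p t).1 - (p t₀).1| ≤ 10 * |t - t₀| := fun t ht => by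
    linarith [hlip t ht, abs_nonneg ((p t).2 - (p t₀).2)]
  have hlip2 : ∀ t ∈ Set.Icc (-h) h, |(p t).2 - (p t₀).2| ≤ 10 * |t - t₀| := fun t ht => by
    linarith [hlip t ht, abs_nonneg ((p t).1 - (p t₀).1)]
  let f : ℝ × (ℝ × ℝ) → ℝ × ℝ := fun q =>
    (gradδ (px q.1) y q.2.1 q.2.2, gradθ (px q.1) y q.2.1 q.2.2)
  have hdf : DifferentiableAt ℝ f (t₀, p t₀) := by
    have hx : ∀ i, DifferentiableAt ℝ (fun q : ℝ × (ℝ × ℝ) => px q.1 i) (t₀, p t₀) := by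
      intro i
      simp only [hpx]
      split_ifs <;> fun_prop
    have := differentiableAt_grad (p := (t₀, p t₀)) (g := fun q : ℝ × (ℝ × ℝ) => q.2.1)
      (k := fun q : ℝ × (ℝ × ℝ) => q.2.2) hx (by fun_prop) (by fun_prop) H₀.abs_x_le
      (fun i => (H₀.abs_y_le i).trans (by norm_num))
      ((mem_centralSquare.1 (hp t₀ ht₀).1).1.trans (by linarith))
    exact this.1.prodMk this.2
  have hD : ∀ v, 1 / 10 * ‖v‖ ≤ ‖fderiv ℝ f (t₀, p t₀) (0, v)‖ := by
    have hc : HasFDerivAt (fun q => f (t₀, q))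
        ((fderiv ℝ f (t₀, p t₀)).comp (ContinuousLinearMap.inr ℝ ℝ (ℝ × ℝ))) (p t₀) :=
      hdf.hasFDerivAt.comp (p t₀) (hasFDerivAt_prodMk_right t₀ (p t₀))
    have hl := H₀.argmin_le (hp t₀ ht₀).1 (hp t₀ ht₀).2
    have hn : centralSquare (100 * h) ∈ nhds (p t₀) := by
      have k1 := abs_le.1 (by linarith [abs_nonneg (p t₀).2] : |(p t₀).1| ≤ 24 * h)
      have k2 := abs_le.1 (by linarith [abs_nonneg (p t₀).1] : |(p t₀).2| ≤ 24 * h)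
      exact prod_mem_nhds (Icc_mem_nhds (by linarith) (by linarith))
        (Icc_mem_nhds (by linarith) (by linarith))
    exact norm_fderiv_ge_of_eventually hc
      (by filter_upwards [hn] with q hq using H₀.norm_grad_sub_ge hq (hp t₀ ht₀).1)
  obtain ⟨p', hp'⟩ := exists_hasDerivWithinAt_of_zeros (C := 10) (s := Set.Icc (-h) h)
    hdf.hasFDerivAt (by norm_num) hD
    (fun t ht => max_le (hlip1 t ht) (hlip2 t ht))
    (fun t ht => by
      have := (H t ht).grad_eq_zero (hp t ht).1 (hp t ht).2
      exact Prod.ext this.1 this.2) ht₀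
  have hb := neBot_nhdsWithin_Icc_diff (by linarith : -h < h) ht₀
  have d1 : HasDerivWithinAt (fun t => (p t).1) p'.1 (Set.Icc (-h) h) t₀ := by
    simpa using hp'.hasFDerivWithinAt.fst.hasDerivWithinAt
  have d2 : HasDerivWithinAt (fun t => (p t).2) p'.2 (Set.Icc (-h) h) t₀ := by
    simpa using hp'.hasFDerivWithinAt.snd.hasDerivWithinAt
  exact ⟨p'.1, p'.2, d1, d2, abs_le_of_hasDerivWithinAt_of_lipschitz d1 hb hlip1,
    abs_le_of_hasDerivWithinAt_of_lipschitz d2 hb hlip2⟩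

theorem abs_deriv_div_cos_le {δ θ δ' θ' : ℝ} (hδ : |δ| ≤ 1) (hθ : |θ| ≤ 1 / 2) (hδ' : |δ'| ≤ 10)
    (hθ' : |θ'| ≤ 10) :
    0 < cos θ ∧ |(δ' * cos θ - δ * (-sin θ * θ')) / cos θ ^ 2| ≤ 100 := by
  have hc : 3 / 4 ≤ cos θ := by
    have := Real.one_sub_sq_div_two_le_cos (x := θ)
    have := sq_le_sq.2 (hθ.trans (le_abs_self _))
    linarith
  have hc0 : 0 < cos θ := by linarith
  refine ⟨hc0, ?_⟩
  rw [abs_div, abs_of_pos (pow_pos hc0 2), div_le_iff₀ (pow_pos hc0 2)]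
  have h1 : |δ' * cos θ| ≤ 10 * 1 := by
    rw [abs_mul]
    exact mul_le_mul hδ' (abs_cos_le_one θ) (abs_nonneg _) (by norm_num)
  have h2 : |δ * (-sin θ * θ')| ≤ 1 * (1 * 10) := by
    rw [abs_mul, abs_mul, abs_neg]
    exact mul_le_mul hδ (mul_le_mul (abs_sin_le_one θ) hθ' (abs_nonneg _) zero_le_one)
      (by positivity) zero_le_one
  have h3 := abs_sub (δ' * cos θ) (δ * (-sin θ * θ'))
  nlinarith

/-- **Regularity Lemma.** Fix `n ≥ 3` and `h = 10⁻⁹ n⁻²`.  With one point in the lower square,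
`n−2` points in the central square and the last point in the upper rectangle (its horizontal
coordinate `x = xₙ ∈ [−h,h]` being the variable), the function `G(·,·;x)` has a unique minimum
`(δ̂(x), θ̂(x))` in `Ω = {|δ| ≤ 100h, |θ| ≤ 100h}`, and `ζ(x) = δ̂(x)/cos θ̂(x)` is differentiable
with `|ζ′(x)| ≤ D`, where `D > 0` depends only on `n` and `h`. -/
theorem regularity_lemma (n : ℕ) (hn : 3 ≤ n) (h : ℝ) (hh : h = 1e-9 / (n : ℝ) ^ 2) :
    ∃ D > 0, ∀ X Y : Fin n → ℝ,
      -- the first point lies in the lower square [−h²,h²] × [−1−h²,−1+h²]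
      |X ⟨0, by omega⟩| ≤ h ^ 2 → Y ⟨0, by omega⟩ ∈ Set.Icc (-1 - h ^ 2) (-1 + h ^ 2) →
      -- the middle n−2 points lie in the central square [−h²,h²] × [−h²,h²]
      (∀ i : Fin n, 1 ≤ (i : ℕ) → (i : ℕ) < n - 1 → |X i| ≤ h ^ 2 ∧ |Y i| ≤ h ^ 2) →
      -- the vertical coordinate of the last point lies in [1−h², 1+h²]
      Y ⟨n - 1, by omega⟩ ∈ Set.Icc (1 - h ^ 2) (1 + h ^ 2) →
      -- the data for the variable horizontal coordinate x = xₙ of the last point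
      ∀ px : ℝ → Fin n → ℝ,
        (∀ t : ℝ, ∀ i : Fin n, px t i = if (i : ℕ) = n - 1 then t else X i) →
        -- (1) unique minimum of G(·,·;x) on Ω for every x ∈ [−h,h]
        (∀ t ∈ Set.Icc (-h) h,
          ∃! p : ℝ × ℝ,
            p ∈ Set.Icc (-(100 * h)) (100 * h) ×ˢ Set.Icc (-(100 * h)) (100 * h) ∧
            IsMinOn (fun q : ℝ × ℝ => Gfun (px t) Y q.1 q.2)
              (Set.Icc (-(100 * h)) (100 * h) ×ˢ Set.Icc (-(100 * h)) (100 * h)) p) ∧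
        -- (2) for the minimizing selection (δ̂, θ̂), ζ = δ̂ / cos θ̂ is differentiable
        --     with derivative bounded by D
        (∀ δhat θhat : ℝ → ℝ,
          (∀ t ∈ Set.Icc (-h) h,
            (δhat t, θhat t) ∈ Set.Icc (-(100 * h)) (100 * h) ×ˢ Set.Icc (-(100 * h)) (100 * h) ∧
            IsMinOn (fun q : ℝ × ℝ => Gfun (px t) Y q.1 q.2)
              (Set.Icc (-(100 * h)) (100 * h) ×ˢ Set.Icc (-(100 * h)) (100 * h))
              (δhat t, θhat t)) →
          ∃ ζ' : ℝ → ℝ, ∀ t ∈ Set.Icc (-h) h,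
            HasDerivWithinAt (fun s => δhat s / Real.cos (θhat s)) (ζ' t)
              (Set.Icc (-h) h) t ∧ |ζ' t| ≤ D) := by
  have hn3 : (3 : ℝ) ≤ n := by exact_mod_cast hn
  have hn0 : (0 : ℝ) < n := by linarith
  have h0 : 0 < h := by rw [hh]; positivity
  have hle : 100 * h ≤ 1.2e-8 := by
    rw [hh, ← mul_div_assoc, div_le_iff₀ (by positivity)]
    nlinarith
  have hmul : n * h ≤ 1e-9 := by
    rw [hh, ← mul_div_assoc, div_le_iff₀ (by positivity)]
    nlinarith
  refine ⟨100, by norm_num, ?_⟩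
  intro X Y hX0 hY0 hmid hY1 px hpx
  have hpx' : ∀ t i, px t i = if i = (⟨n - 1, by omega⟩ : Fin n) then t else X i := by
    intro t i
    simp only [hpx, Fin.ext_iff]
  have H : ∀ t ∈ Set.Icc (-h) h, NearCross h ⟨0, by omega⟩ ⟨n - 1, by omega⟩ (px t) Y := by
    intro t ht
    have hne : (⟨0, by omega⟩ : Fin n) ≠ ⟨n - 1, by omega⟩ := by
      rw [Ne, Fin.ext_iff]; dsimp only; omega
    have hm : ∀ i : Fin n, i ≠ ⟨0, by omega⟩ → i ≠ ⟨n - 1, by omega⟩ →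
        |X i| ≤ h ^ 2 ∧ |Y i| ≤ h ^ 2 := by
      intro i hi0 hi1
      rw [Ne, Fin.ext_iff] at hi0 hi1
      dsimp only at hi0 hi1
      exact hmid i (by omega) (by omega)
    refine ⟨hne, hn, h0, hle, hmul, ?_, ?_, ?_, ?_, ?_, ?_⟩
    · rwa [hpx', if_neg hne]
    · rw [abs_le]; constructor <;> linarith [hY0.1, hY0.2]
    · rw [hpx', if_pos rfl]; exact abs_le.2 ht
    · rw [abs_le]; constructor <;> linarith [hY1.1, hY1.2]
    · intro i hi0 hi1
      rw [hpx', if_neg hi1]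
      exact (hm i hi0 hi1).1
    · intro i hi0 hi1
      exact (hm i hi0 hi1).2
  refine ⟨fun t ht => (H t ht).existsUnique_argmin, ?_⟩
  intro δhat θhat hmin
  have key : ∀ t ∈ Set.Icc (-h) h, ∃ d, HasDerivWithinAt (fun s => δhat s / cos (θhat s)) d
      (Set.Icc (-h) h) t ∧ |d| ≤ 100 := by
    intro t ht
    obtain ⟨δ', θ', d1, d2, b1, b2⟩ := exists_hasDerivWithinAt_argmin hpx' H hmin ht
    have hm := mem_centralSquare.1 (hmin t ht).1
    obtain ⟨c1, c2⟩ := abs_deriv_div_cos_le (hm.1.trans (by linarith)) (hm.2.trans (by linarith))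
      b1 b2
    exact ⟨_, d1.fun_div d2.cos c1.ne', c2⟩
  choose! d hd using key
  exact ⟨d, hd⟩
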